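/- Let n be a natural number, G the 2×2 matrix [[1,0],[1,1]] over ZMod 2, and σ a permutation of Fin n. For every message word u : Fin (2^n) → ZMod 2, encoding the digit-permuted message and permuting the codeword commute: (u ∘ π_σ) * G^{⊗n} = (u * G^{⊗n}) ∘ π_σ, where * denotes vector–matrix multiplication. Hence decoding a polar code on the factor graph with layers permuted by σ is equivalent to decoding on the original factor graph with the codeword positions permuted by π_σ. -/

import Mathlib

/-- The `k`-th binary digit of the natural number `i`. -/
def bit (k i : ℕ) : ℕ := i / 2 ^ k % 2

/-- The digit permutation `π_σ` on `Fin (2 ^ n)` induced by a permutation `σ` of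
`Fin n`: it sends `i` to the index `j` with `bit (σ k) j = bit k i` for all `k`. -/
def digitPerm (n : ℕ) (σ : Equiv.Perm (Fin n)) (i : Fin (2 ^ n)) : Fin (2 ^ n) :=
  ⟨(∑ k : Fin n, bit k i.val * 2 ^ (σ k : ℕ)) % 2 ^ n, Nat.mod_lt _ (by positivity)⟩

/-- The identification `Fin 2 × Fin (2 ^ n) ≃ Fin (2 ^ (n + 1))` sending `(a, b)`
to the index whose top binary digit is `a` and whose lower `n` digits are `b`. -/
def pow2Equiv (n : ℕ) : Fin 2 × Fin (2 ^ n) ≃ Fin (2 ^ (n + 1)) :=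
  finProdFinEquiv.trans (finCongr (by ring))

/-- The iterated Kronecker product `A (n-1) ⊗ A (n-2) ⊗ ⋯ ⊗ A 0`, defined layer
by layer, viewed as a `2 ^ n × 2 ^ n` matrix indexed by `Fin (2 ^ n)`. -/
def iterKron {R : Type*} [CommRing R] :
    (n : ℕ) → (Fin n → Matrix (Fin 2) (Fin 2) R) →
      Matrix (Fin (2 ^ n)) (Fin (2 ^ n)) R
  | 0, _ => 1
  | n + 1, A =>
      Matrix.reindex (pow2Equiv n) (pow2Equiv n)
        (Matrix.kroneckerMap (· * ·) (A (Fin.last n)) (iterKron n (A ∘ Fin.castSucc)))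

/-- The digit permutation relabels the digit vector along `σ`. -/
theorem digitPerm_eq (n : ℕ) (σ : Equiv.Perm (Fin n)) (i : Fin (2 ^ n)) :
    digitPerm n σ i = finFunctionFinEquiv (finFunctionFinEquiv.symm i ∘ σ.symm) := by
  have hsum : ∑ k : Fin n, bit k i.val * 2 ^ (σ k : ℕ) =
      (finFunctionFinEquiv (finFunctionFinEquiv.symm i ∘ σ.symm)).val := by
    rw [finFunctionFinEquiv_apply, ← Equiv.sum_comp σ (fun k : Fin n =>
      ((finFunctionFinEquiv.symm i ∘ σ.symm) k).val * 2 ^ (k : ℕ))]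
    simp [finFunctionFinEquiv_symm_apply_val, bit]
  apply Fin.ext
  simp only [digitPerm]
  rw [hsum, Nat.mod_eq_of_lt (Fin.is_lt _)]

theorem finFunctionFinEquiv_symm_digitPerm (n : ℕ) (σ : Equiv.Perm (Fin n)) (i : Fin (2 ^ n))
    (k : Fin n) : finFunctionFinEquiv.symm (digitPerm n σ i) (σ k) =
      finFunctionFinEquiv.symm i k := by
  simp [digitPerm_eq]

theorem digitPerm_bijective (n : ℕ) (σ : Equiv.Perm (Fin n)) :
    Function.Bijective (digitPerm n σ) := by
  refine Function.Injective.bijective_of_finite fun i j h => ?_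
  apply finFunctionFinEquiv.symm.injective
  funext k
  rw [← finFunctionFinEquiv_symm_digitPerm n σ i, h, finFunctionFinEquiv_symm_digitPerm]

theorem finFunctionFinEquiv_symm_pow2Equiv_last (n : ℕ) (p : Fin 2 × Fin (2 ^ n)) :
    finFunctionFinEquiv.symm (pow2Equiv n p) (Fin.last n) = p.1 := by
  apply Fin.ext
  have h : (p.2.val + 2 ^ n * p.1.val) / 2 ^ n = p.1.val := by
    rw [Nat.add_mul_div_left _ _ (by positivity), Nat.div_eq_of_lt p.2.is_lt, zero_add]
  simp [finFunctionFinEquiv_symm_apply_val, pow2Equiv, finProdFinEquiv, h,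
    Nat.mod_eq_of_lt p.1.is_lt]

theorem finFunctionFinEquiv_symm_pow2Equiv_castSucc (n : ℕ) (p : Fin 2 × Fin (2 ^ n))
    (k : Fin n) :
    finFunctionFinEquiv.symm (pow2Equiv n p) k.castSucc = finFunctionFinEquiv.symm p.2 k := by
  apply Fin.ext
  have h : (p.2.val + 2 ^ n * p.1.val) / 2 ^ k.val % 2 = p.2.val / 2 ^ k.val % 2 := by
    obtain ⟨m, hm⟩ := Nat.exists_eq_add_of_lt k.is_lt
    have hn : 2 ^ n * p.1.val = 2 ^ k.val * (2 * (2 ^ m * p.1.val)) := by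
      have hpow : 2 ^ n = 2 ^ k.val * (2 * 2 ^ m) := by
        rw [← pow_succ', ← pow_add, ← add_assoc, ← hm]
      calc 2 ^ n * p.1.val = 2 ^ k.val * (2 * 2 ^ m) * p.1.val := congrArg (· * p.1.val) hpow
        _ = _ := by ring
    rw [hn, Nat.add_mul_div_left _ _ (by positivity), Nat.add_mul_mod_self_left]
  simpa [finFunctionFinEquiv_symm_apply_val, pow2Equiv, finProdFinEquiv] using h

/-- Entries of an iterated Kronecker product are products over the binary digits. -/
theorem iterKron_apply {R : Type*} [CommRing R] (n : ℕ) (A : Fin n → Matrix (Fin 2) (Fin 2) R)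
    (i j : Fin (2 ^ n)) :
    iterKron n A i j =
      ∏ k, A k (finFunctionFinEquiv.symm i k) (finFunctionFinEquiv.symm j k) := by
  induction n with
  | zero =>
    have h : i = j := Fin.ext (by omega)
    subst h
    simp only [iterKron, Finset.univ_eq_empty, Finset.prod_empty]
    exact Matrix.one_apply_eq i
  | succ n ih =>
    obtain ⟨p, rfl⟩ := (pow2Equiv n).surjective i
    obtain ⟨q, rfl⟩ := (pow2Equiv n).surjective j
    simp only [Fin.prod_univ_castSucc, finFunctionFinEquiv_symm_pow2Equiv_last,
      finFunctionFinEquiv_symm_pow2Equiv_castSucc]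
    simp [iterKron, ih, mul_comm]

/-- Simultaneously permuting row and column digits of an iterated Kronecker product permutes
its layers. -/
theorem iterKron_digitPerm {R : Type*} [CommRing R] (n : ℕ) (σ : Equiv.Perm (Fin n))
    (A : Fin n → Matrix (Fin 2) (Fin 2) R) (i j : Fin (2 ^ n)) :
    iterKron n A (digitPerm n σ i) (digitPerm n σ j) = iterKron n (A ∘ σ) i j := by
  simp only [iterKron_apply]
  rw [← Equiv.prod_comp σ]
  simp only [finFunctionFinEquiv_symm_digitPerm, Function.comp_apply]

/-- For every message word `u` over `GF(2)`, encoding the digit-permuted message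
with the polar generator matrix `G^{⊗n}` and permuting the codeword commute:
`(u ∘ π_σ) ⬝ G^{⊗n} = (u ⬝ G^{⊗n}) ∘ π_σ`. Hence decoding on the factor graph
with layers permuted by `σ` is equivalent to decoding on the original factor
graph with the codeword positions permuted by `π_σ`. -/
theorem encode_digitPerm_comm (n : ℕ) (σ : Equiv.Perm (Fin n))
    (u : Fin (2 ^ n) → ZMod 2) :
    Matrix.vecMul (u ∘ digitPerm n σ)
        (iterKron n (fun _ => (!![1, 0; 1, 1] : Matrix (Fin 2) (Fin 2) (ZMod 2)))) =
      (Matrix.vecMul u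
        (iterKron n (fun _ => (!![1, 0; 1, 1] : Matrix (Fin 2) (Fin 2) (ZMod 2))))) ∘
        digitPerm n σ := by
  funext j
  simp only [Matrix.vecMul_eq_sum, Finset.sum_apply, Pi.smul_apply, Function.comp_apply]
  refine (Finset.sum_congr rfl fun i _ => ?_).trans
    ((digitPerm_bijective n σ).sum_comp fun i => u i • iterKron n _ i (digitPerm n σ j))
  exact congrArg (u (digitPerm n σ i) • ·) (iterKron_digitPerm n σ (fun _ => _) i j).symm
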